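/- Let f(t) = Σ_{j=1}^K γ_j cos(2π a_j t + b_j) with γ_j ∈ (0,∞), pairwise distinct a_j ∈ (0,∞), b_j ∈ [0,2π), P > 0, a_j P ∉ ℕ for all j, and let C_j = a_j²P², A_j = −(Pγ_j a_j/π) sin(a_jπP) cos(a_jπP + b_j), B_j = −(γ_j/π) sin(a_jπP) sin(a_jπP + b_j), and c̃_n = Re c_n(f) + (i/n) Im c_n(f). Let S = {n_1,…,n_{K+1}} be pairwise distinct positive integers and Γ' a set of at least K positive integers disjoint from S. Then: (i) for all distinct positive integers n, k one has (c̃_n − c̃_k)/(n² − k²) = −Σ_{j=1}^K (A_j + i B_j)/((n² − C_j)(k² − C_j)); (ii) the matrix A = ((c̃_n − c̃_{n_ℓ})/(n² − n_ℓ²))_{n ∈ Γ', ℓ=1,…,K+1} factors as A = C₁ D C₂ with C₁ = (1/(n² − C_j))_{n∈Γ', j=1,…,K}, D = diag(−(A_j + iB_j))_{j=1}^K, C₂ = (1/(n_ℓ² − C_j))_{j=1,…,K, ℓ=1,…,K+1}, and has rank exactly K, so its kernel is one-dimensional; (iii) every nonzero vector in the kernel of A has all K+1 components nonzero. -/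

import Mathlib

open Real Finset

/-- The classical Fourier coefficient `c_n(f)` of `f : ℝ → ℝ` with respect to the
interval `(0, P)`: `c_n(f) = (1/P) ∫₀^P f(t) e^{-2πi n t / P} dt`. -/
noncomputable def fourierCoef (P : ℝ) (f : ℝ → ℝ) (n : ℤ) : ℂ :=
  (1 / (P : ℂ)) * ∫ t in (0:ℝ)..P,
    (f t : ℂ) * Complex.exp (-2 * (π : ℂ) * Complex.I * (n : ℂ) * (t : ℂ) / (P : ℂ))

/-- A linear combination of the simple fractions `1 / (x - y j)` which vanishes at as many points
as it has terms has zero coefficients. -/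
theorem coeff_eq_zero_of_sum_div_sub_eq_zero {F ι : Type*} [Field F] [Fintype ι]
    (y w : ι → F) (hy : Function.Injective y) (s : Finset F) (hs : Fintype.card ι ≤ s.card)
    (hne : ∀ x ∈ s, ∀ j, x ≠ y j) (h : ∀ x ∈ s, ∑ j, w j / (x - y j) = 0) (j : ι) : w j = 0 := by
  classical
  set Q : Polynomial F :=
    ∑ j, Polynomial.C (w j) * ∏ i ∈ univ.erase j, (Polynomial.X - Polynomial.C (y i)) with hQ
  have hdeg : Q.degree < s.card := by
    refine (Polynomial.degree_sum_le _ _).trans_lt ((Finset.sup_lt_iff ?_).2 fun j _ => ?_)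
    · exact WithBot.bot_lt_coe _
    · refine (Polynomial.degree_mul_le _ _).trans_lt ?_
      refine (add_le_add_left Polynomial.degree_C_le _).trans_lt ?_
      rw [zero_add, Polynomial.degree_prod]
      simp only [Polynomial.degree_X_sub_C, Finset.sum_const, Finset.card_erase_of_mem (mem_univ j),
        Finset.card_univ, nsmul_eq_mul, mul_one]
      have : 0 < Fintype.card ι := Fintype.card_pos_iff.2 ⟨j⟩
      exact_mod_cast (by omega : Fintype.card ι - 1 < s.card)
  have hQ0 : Q = 0 := by
    refine Polynomial.eq_zero_of_degree_lt_of_eval_finset_eq_zero s hdeg fun x hx => ?_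
    have hmul := congrArg (· * ∏ i, (x - y i)) (h x hx)
    simp only [zero_mul, Finset.sum_mul] at hmul
    rw [hQ, Polynomial.eval_finsetSum, ← hmul]
    refine Finset.sum_congr rfl fun j _ => ?_
    have hj : x - y j ≠ 0 := sub_ne_zero.2 (hne x hx j)
    rw [← Finset.mul_prod_erase univ _ (mem_univ j)]
    simp only [Polynomial.eval_mul, Polynomial.eval_C, Polynomial.eval_prod, Polynomial.eval_sub,
      Polynomial.eval_X]
    field_simp
  have heval : Q.eval (y j) = w j * ∏ i ∈ univ.erase j, (y j - y i) := by
    rw [hQ, Polynomial.eval_finsetSum, Finset.sum_eq_single j]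
    · simp [Polynomial.eval_prod]
    · intro i _ hij
      simp only [Polynomial.eval_mul, Polynomial.eval_prod]
      rw [Finset.prod_eq_zero (i := j)] <;> simp [hij.symm]
    · simp
  rw [hQ0, Polynomial.eval_zero] at heval
  refine (mul_eq_zero.1 heval.symm).resolve_right (Finset.prod_ne_zero_iff.2 fun i hi => ?_)
  exact sub_ne_zero.2 fun he => (Finset.mem_erase.1 hi).1 (hy he).symm

/-- The Fourier coefficients on `(0, P)` of a cosine which is not `P`-periodic. -/
theorem fourierCoef_cos {P a : ℝ} (hP : 0 < P) (b : ℝ) (n : ℤ) (h₁ : a * P ≠ n)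
    (h₂ : a * P ≠ -n) :
    fourierCoef P (fun t => Real.cos (2 * π * a * t + b)) n =
      ((Real.sin (a * π * P) / (π * ((a * P) ^ 2 - (n : ℝ) ^ 2)) : ℝ) : ℂ) *
        ((a * P * Real.cos (a * π * P + b) : ℝ) +
          Complex.I * (n * Real.sin (a * π * P + b) : ℝ)) := by
  have hPc : (P : ℂ) ≠ 0 := by exact_mod_cast hP.ne'
  have hpi : (π : ℂ) ≠ 0 := by exact_mod_cast Real.pi_ne_zero
  have hI := Complex.I_ne_zero
  have h₁c : (a : ℂ) * P - n ≠ 0 := sub_ne_zero.2 (by exact_mod_cast h₁)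
  have h₂c : (a : ℂ) * P + n ≠ 0 := by
    rw [← sub_neg_eq_add]
    exact sub_ne_zero.2 (by exact_mod_cast h₂)
  have h₂c' : -((a : ℂ) * P) - n ≠ 0 := by
    rw [← neg_add']
    exact neg_ne_zero.2 h₂c
  have hc₁ : 2 * π * Complex.I * ((a * P - n) / P) ≠ 0 :=
    mul_ne_zero Complex.two_pi_I_ne_zero (div_ne_zero h₁c hPc)
  have hc₂ : 2 * π * Complex.I * ((-(a * P) - n) / P) ≠ 0 :=
    mul_ne_zero Complex.two_pi_I_ne_zero (div_ne_zero h₂c' hPc)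
  have hintegrand : ∀ t : ℝ, ((Real.cos (2 * π * a * t + b) : ℝ) : ℂ) *
      Complex.exp (-2 * (π : ℂ) * Complex.I * (n : ℂ) * (t : ℂ) / (P : ℂ)) =
      Complex.exp (b * Complex.I) / 2 *
          Complex.exp (2 * π * Complex.I * ((a * P - n) / P) * t) +
        Complex.exp (-(b * Complex.I)) / 2 *
          Complex.exp (2 * π * Complex.I * ((-(a * P) - n) / P) * t) := by
    intro t
    rw [Complex.ofReal_cos, Complex.cos, div_mul_eq_mul_div, add_mul, ← Complex.exp_add,
      ← Complex.exp_add, div_mul_eq_mul_div, div_mul_eq_mul_div, ← Complex.exp_add,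
      ← Complex.exp_add, ← add_div]
    congr 3 <;> push_cast <;> field_simp <;> ring
  have hperiod : Complex.exp (-(n * (2 * π * Complex.I))) = 1 := by
    simpa using Complex.exp_int_mul_two_pi_mul_I (-n)
  have hexp₁ : Complex.exp (2 * π * Complex.I * ((a * P - n) / P) * P) =
      Complex.exp (a * π * P * Complex.I) * Complex.exp (a * π * P * Complex.I) := by
    rw [← Complex.exp_add, ← mul_one (Complex.exp (_ + _)), ← hperiod, ← Complex.exp_add]
    congr 1
    field_simp
    ring
  have hexp₂ : Complex.exp (2 * π * Complex.I * ((-(a * P) - n) / P) * P) =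
      (Complex.exp (a * π * P * Complex.I))⁻¹ * (Complex.exp (a * π * P * Complex.I))⁻¹ := by
    rw [← Complex.exp_neg, ← Complex.exp_add, ← mul_one (Complex.exp (_ + _)), ← hperiod,
      ← Complex.exp_add]
    congr 1
    field_simp
    ring
  have hcont : ∀ c d : ℂ, IntervalIntegrable (fun t : ℝ => d * Complex.exp (c * t))
      MeasureTheory.volume 0 P := fun c d =>
    Continuous.intervalIntegrable (by fun_prop) _ _
  rw [fourierCoef]
  simp only [hintegrand]
  rw [intervalIntegral.integral_add (hcont _ _) (hcont _ _), intervalIntegral.integral_const_mul,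
    intervalIntegral.integral_const_mul, integral_exp_mul_complex hc₁,
    integral_exp_mul_complex hc₂, hexp₁, hexp₂]
  push_cast
  rw [Complex.sin, Complex.sin, Complex.cos]
  simp only [neg_mul, add_mul, neg_add, Complex.exp_add, Complex.exp_neg, mul_zero, Complex.exp_zero]
  have hU := Complex.exp_ne_zero (a * π * P * Complex.I)
  have hV := Complex.exp_ne_zero (b * Complex.I)
  set U := Complex.exp (a * π * P * Complex.I)
  set V := Complex.exp (b * Complex.I)
  have hsq : ((a : ℂ) * P) ^ 2 - (n : ℂ) ^ 2 = (a * P - n) * (a * P + n) := by ring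
  have hneg : -((a : ℂ) * P) - n = -(a * P + n) := by ring
  rw [hsq, hneg]
  have hsum : (a : ℂ) * P = ((a * P - n) + (a * P + n)) / 2 := by ring
  have hdif : (n : ℂ) = ((a * P + n) - (a * P - n)) / 2 := by ring
  generalize (a : ℂ) * P - n = d at *
  generalize (a : ℂ) * P + n = e at *
  rw [hsum, hdif]
  field_simp
  ring_nf
  simp only [Complex.I_sq, Complex.I_pow_four]
  ring

/-- The Fourier coefficients are linear in the function. -/
theorem fourierCoef_sum {ι : Type*} [Fintype ι] (P : ℝ) (γ : ι → ℝ) (g : ι → ℝ → ℝ)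
    (hg : ∀ j, Continuous (g j)) (n : ℤ) :
    fourierCoef P (fun t => ∑ j, γ j * g j t) n = ∑ j, (γ j : ℂ) * fourierCoef P (g j) n := by
  simp only [fourierCoef]
  push_cast
  simp only [Finset.sum_mul]
  rw [intervalIntegral.integral_finsetSum, Finset.mul_sum]
  · refine Finset.sum_congr rfl fun j _ => ?_
    simp only [mul_assoc, intervalIntegral.integral_const_mul]
    ring
  · intro j _
    have := hg j
    exact Continuous.intervalIntegrable (by fun_prop) _ _

/-- **Structure of the AAA loss matrix in the case of exact data.**
For a non-harmonic Fourier sum `f` with `K` non-`P`-periodic terms, with modified Fourier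
coefficients `c̃_n` and the parameters `A_j, B_j, C_j`:
(i) `(c̃_n − c̃_k)/(n² − k²) = −Σ_j (A_j + iB_j)/((n² − C_j)(k² − C_j))` for distinct positive
integers `n, k`;  (ii) the matrix `A = ((c̃_n − c̃_{n_ℓ})/(n² − n_ℓ²))_{n∈Γ', ℓ}` factors
as `C₁ D C₂` and has rank exactly `K`, so its kernel is one-dimensional;
(iii) every nonzero kernel vector of `A` has all `K+1` components nonzero. -/
theorem statement14 (P : ℝ) (hP : 0 < P) (K : ℕ) (hK : 0 < K)
    (γ a b : Fin K → ℝ) (hγ : ∀ j, 0 < γ j) (ha : ∀ j, 0 < a j)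
    (hainj : Function.Injective a) (hb : ∀ j, b j ∈ Set.Ico 0 (2 * π))
    (hnp : ∀ j, ∀ m : ℕ, a j * P ≠ (m : ℝ))
    (f : ℝ → ℝ) (hf : ∀ t, f t = ∑ j, γ j * Real.cos (2 * π * a j * t + b j))
    (Cp Ap Bp : Fin K → ℝ)
    (hCp : ∀ j, Cp j = (a j) ^ 2 * P ^ 2)
    (hAp : ∀ j, Ap j = -(P * γ j * a j / π)
      * Real.sin (a j * π * P) * Real.cos (a j * π * P + b j))
    (hBp : ∀ j, Bp j = -(γ j / π)
      * Real.sin (a j * π * P) * Real.sin (a j * π * P + b j))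
    (ctil : ℕ → ℂ)
    (hctil : ∀ m : ℕ, ctil m = ((fourierCoef P f m).re : ℂ)
      + Complex.I / (m : ℂ) * ((fourierCoef P f m).im : ℂ))
    (S : Fin (K + 1) → ℕ) (hS : ∀ ℓ, 0 < S ℓ) (hSinj : Function.Injective S)
    (Γ' : Finset ℕ) (hΓcard : K ≤ Γ'.card) (hΓpos : ∀ m ∈ Γ', 0 < m)
    (hdisj : ∀ m ∈ Γ', ∀ ℓ, m ≠ S ℓ)
    (A : Matrix {x // x ∈ Γ'} (Fin (K + 1)) ℂ)
    (hA : ∀ m ℓ, A m ℓ = (ctil (m : ℕ) - ctil (S ℓ))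
      / (((m : ℕ) : ℂ) ^ 2 - ((S ℓ : ℕ) : ℂ) ^ 2))
    (C₁ : Matrix {x // x ∈ Γ'} (Fin K) ℂ)
    (hC₁ : ∀ m j, C₁ m j = 1 / (((m : ℕ) : ℂ) ^ 2 - (Cp j : ℂ)))
    (D : Matrix (Fin K) (Fin K) ℂ)
    (hD : D = Matrix.diagonal (fun j => -((Ap j : ℂ) + Complex.I * (Bp j : ℂ))))
    (C₂ : Matrix (Fin K) (Fin (K + 1)) ℂ)
    (hC₂ : ∀ j ℓ, C₂ j ℓ = 1 / (((S ℓ : ℕ) : ℂ) ^ 2 - (Cp j : ℂ))) :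
    (∀ m k : ℕ, 0 < m → 0 < k → m ≠ k →
      (ctil m - ctil k) / ((m : ℂ) ^ 2 - (k : ℂ) ^ 2)
        = -∑ j, ((Ap j : ℂ) + Complex.I * (Bp j : ℂ))
            / (((m : ℂ) ^ 2 - (Cp j : ℂ)) * ((k : ℂ) ^ 2 - (Cp j : ℂ))))
    ∧ A = C₁ * D * C₂
    ∧ A.rank = K
    ∧ Module.finrank ℂ (LinearMap.ker A.mulVecLin) = 1
    ∧ ∀ v : Fin (K + 1) → ℂ, A.mulVec v = 0 → v ≠ 0 → ∀ ℓ, v ℓ ≠ 0 := by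
  have hx : ∀ j, 0 < a j * P := fun j => mul_pos (ha j) hP
  have hCinj : Function.Injective fun j => (Cp j : ℂ) := by
    intro i j hij
    have hij' : (a i * P) ^ 2 = (a j * P) ^ 2 := by
      rw [mul_pow, mul_pow, ← hCp, ← hCp]
      exact Complex.ofReal_injective hij
    exact hainj (mul_right_cancel₀ hP.ne' ((sq_eq_sq₀ (hx i).le (hx j).le).1 hij'))
  have hCne : ∀ (m : ℕ) j, ((m : ℂ) ^ 2 - (Cp j : ℂ)) ≠ 0 := by
    intro m j h
    have h' : (m : ℝ) ^ 2 = (a j * P) ^ 2 := by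
      rw [mul_pow, ← hCp]
      exact_mod_cast sub_eq_zero.1 h
    exact hnp j m ((sq_eq_sq₀ m.cast_nonneg (hx j).le).1 h').symm
  have hsqinj : Function.Injective fun m : ℕ => (m : ℂ) ^ 2 := by
    intro m k h
    have h' : m ^ 2 = k ^ 2 := by
      beta_reduce at h
      exact_mod_cast h
    exact Nat.pow_left_injective two_ne_zero h'
  have hctil' : ∀ m : ℕ, 0 < m →
      ctil m = ∑ j, ((Ap j : ℂ) + Complex.I * (Bp j : ℂ)) / ((m : ℂ) ^ 2 - (Cp j : ℂ)) := by
    intro m hm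
    have hmc : (m : ℂ) ≠ 0 := by exact_mod_cast hm.ne'
    have hcoef : fourierCoef P f m =
        ((∑ j, γ j * (Real.sin (a j * π * P) / (π * ((a j * P) ^ 2 - (m : ℝ) ^ 2)) *
            (a j * P * Real.cos (a j * π * P + b j))) : ℝ) : ℂ) +
          ((∑ j, γ j * (Real.sin (a j * π * P) / (π * ((a j * P) ^ 2 - (m : ℝ) ^ 2)) *
            (m * Real.sin (a j * π * P + b j))) : ℝ) : ℂ) * Complex.I := by
      rw [funext hf, fourierCoef_sum P γ (fun j t => Real.cos (2 * π * a j * t + b j))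
        (fun j => by fun_prop)]
      rw [Complex.ofReal_sum, Complex.ofReal_sum, Finset.sum_mul, ← Finset.sum_add_distrib]
      refine Finset.sum_congr rfl fun j _ => ?_
      rw [fourierCoef_cos hP (b j) m (by exact_mod_cast hnp j m) fun h => ?_]
      · push_cast
        ring
      · have := hx j
        have : (0 : ℝ) ≤ m := m.cast_nonneg
        push_cast at h
        linarith
    rw [hctil, hcoef, ← Complex.mk_eq_add_mul_I, Complex.ofReal_sum, Complex.ofReal_sum, Finset.mul_sum, ← Finset.sum_add_distrib]
    refine Finset.sum_congr rfl fun j _ => ?_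
    have h := hCne m j
    have h' : (a j : ℂ) ^ 2 * P ^ 2 - m ^ 2 ≠ 0 := by
      rw [hCp] at h
      push_cast at h
      exact neg_ne_zero.1 (by rwa [neg_sub])
    rw [hAp, hBp]
    rw [hCp] at h ⊢
    push_cast at h ⊢
    rw [mul_pow, ← neg_sub ((a j : ℂ) ^ 2 * P ^ 2)]
    have hpi : (π : ℂ) ≠ 0 := by exact_mod_cast Real.pi_ne_zero
    field_simp
    ring
  have hdiff : ∀ m k : ℕ, 0 < m → 0 < k → m ≠ k →
      (ctil m - ctil k) / ((m : ℂ) ^ 2 - (k : ℂ) ^ 2)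
        = -∑ j, ((Ap j : ℂ) + Complex.I * (Bp j : ℂ))
            / (((m : ℂ) ^ 2 - (Cp j : ℂ)) * ((k : ℂ) ^ 2 - (Cp j : ℂ))) := by
    intro m k hm hk hmk
    have hmk' : (m : ℂ) ^ 2 - (k : ℂ) ^ 2 ≠ 0 := sub_ne_zero.2 fun h => hmk (hsqinj h)
    rw [hctil' m hm, hctil' k hk, div_eq_iff hmk', ← Finset.sum_sub_distrib, neg_mul,
      Finset.sum_mul, ← Finset.sum_neg_distrib]
    refine Finset.sum_congr rfl fun j _ => ?_
    have h₁ := hCne m j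
    have h₂ := hCne k j
    field_simp
    ring
  have hfac : A = C₁ * D * C₂ := by
    ext m ℓ
    rw [hA, hdiff m (S ℓ) (hΓpos m m.2) (hS ℓ) (hdisj m m.2 ℓ), hD, Matrix.mul_apply,
      ← Finset.sum_neg_distrib]
    refine Finset.sum_congr rfl fun j _ => ?_
    rw [Matrix.mul_diagonal, hC₁, hC₂]
    have h₁ := hCne m j
    have h₂ := hCne (S ℓ) j
    field_simp
  have hABne : ∀ j, (Ap j : ℂ) + Complex.I * (Bp j : ℂ) ≠ 0 := by
    intro j h
    have hre : Ap j = 0 := by simpa using congrArg Complex.re h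
    have him : Bp j = 0 := by simpa using congrArg Complex.im h
    have hsin : Real.sin (a j * π * P) ≠ 0 := by
      intro h0
      obtain ⟨z, hz⟩ := Real.sin_eq_zero_iff.1 h0
      have hz' : (z : ℝ) = a j * P := mul_right_cancel₀ Real.pi_ne_zero (by linarith)
      have hzpos : 0 < z := by exact_mod_cast hz' ▸ hx j
      refine hnp j z.toNat ?_
      rw [← hz']
      exact_mod_cast (Int.toNat_of_nonneg hzpos.le).symm
    have hg := (hγ j).ne'
    have haj := (ha j).ne'
    have hcos : Real.cos (a j * π * P + b j) = 0 := by
      simpa [hAp, hsin, hg, haj, hP.ne', Real.pi_ne_zero] using hre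
    have hsin' : Real.sin (a j * π * P + b j) = 0 := by
      simpa [hBp, hsin, hg, Real.pi_ne_zero] using him
    have := Real.sin_sq_add_cos_sq (a j * π * P + b j)
    simp [hcos, hsin'] at this
  have hker : ∀ v, A.mulVec v = 0 ↔ C₂.mulVec v = 0 := by
    intro v
    refine ⟨fun h => ?_, fun h => by rw [hfac, ← Matrix.mulVec_mulVec, h, Matrix.mulVec_zero]⟩
    rw [hfac, ← Matrix.mulVec_mulVec, ← Matrix.mulVec_mulVec] at h
    have hw := coeff_eq_zero_of_sum_div_sub_eq_zero _ (D.mulVec (C₂.mulVec v)) hCinj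
      (Γ'.image fun m : ℕ => (m : ℂ) ^ 2)
      (by rwa [Finset.card_image_of_injective _ hsqinj, Fintype.card_fin])
      (by
        simp only [Finset.mem_image, forall_exists_index, and_imp, forall_apply_eq_imp_iff₂]
        exact fun m _ j => sub_ne_zero.1 (hCne m j))
      (by
        simp only [Finset.mem_image, forall_exists_index, and_imp, forall_apply_eq_imp_iff₂]
        intro m hm
        rw [← Pi.zero_apply (M := fun _ => ℂ) (⟨m, hm⟩ : {x // x ∈ Γ'}), ← h]
        refine Finset.sum_congr rfl fun j _ => ?_
        change _ = C₁ ⟨m, hm⟩ j * _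
        rw [hC₁]
        ring)
    funext j
    have := hw j
    rw [hD, Matrix.mulVec_diagonal] at this
    exact (mul_eq_zero.1 this).resolve_left (neg_ne_zero.2 (hABne j))
  have hzero : ∀ v : Fin (K + 1) → ℂ, A.mulVec v = 0 → ∀ ℓ, v ℓ = 0 → v = 0 := by
    intro v hv ℓ hℓ
    rw [hker] at hv
    have hw := coeff_eq_zero_of_sum_div_sub_eq_zero
      (fun i : Fin K => ((S (ℓ.succAbove i) : ℕ) : ℂ) ^ 2) (fun i => v (ℓ.succAbove i))
      (hsqinj.comp (hSinj.comp Fin.succAbove_right_injective))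
      (univ.image fun j => (Cp j : ℂ))
      (by rw [Finset.card_image_of_injective _ hCinj, Finset.card_univ])
      (by
        simp only [Finset.mem_image, Finset.mem_univ, true_and, forall_exists_index,
          forall_apply_eq_imp_iff]
        exact fun j i => (sub_ne_zero.1 (hCne _ j)).symm)
      (by
        simp only [Finset.mem_image, Finset.mem_univ, true_and, forall_exists_index,
          forall_apply_eq_imp_iff]
        intro j
        have hj := congrFun hv j
        simp only [Matrix.mulVec, dotProduct, Pi.zero_apply] at hj
        rw [Fin.sum_univ_succAbove _ ℓ, hℓ, mul_zero, zero_add] at hj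
        rw [← neg_eq_zero, ← hj, ← Finset.sum_neg_distrib]
        refine Finset.sum_congr rfl fun i _ => ?_
        rw [hC₂, ← div_neg, neg_sub]
        ring)
    funext i
    rcases Fin.eq_self_or_eq_succAbove ℓ i with rfl | ⟨i, rfl⟩
    · exact hℓ
    · exact hw i
  have hnull := A.mulVecLin.finrank_range_add_finrank_ker
  rw [Module.finrank_fin_fun] at hnull
  have hkereq : LinearMap.ker A.mulVecLin = LinearMap.ker C₂.mulVecLin := by
    ext v
    simpa using hker v
  have hle : Module.finrank ℂ (LinearMap.ker A.mulVecLin) ≤ 1 := by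
    have hinj : Function.Injective
        ((LinearMap.proj (R := ℂ) (φ := fun _ : Fin (K + 1) => ℂ) 0).comp
          (LinearMap.ker A.mulVecLin).subtype) := by
      rw [← LinearMap.ker_eq_bot, LinearMap.ker_eq_bot']
      rintro ⟨v, hv⟩ h
      exact Subtype.ext (hzero v (by simpa using hv) 0 (by simpa using h))
    simpa using LinearMap.finrank_le_finrank_of_injective hinj
  have hge : 1 ≤ Module.finrank ℂ (LinearMap.ker A.mulVecLin) := by
    have h := C₂.mulVecLin.finrank_range_add_finrank_ker
    have h' : Module.finrank ℂ (LinearMap.range C₂.mulVecLin) ≤ K := by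
      simpa using Submodule.finrank_le (LinearMap.range C₂.mulVecLin)
    rw [Module.finrank_fin_fun, ← hkereq] at h
    omega
  refine ⟨hdiff, hfac, ?_, by omega, fun v hv hv0 ℓ hℓ => hv0 (hzero v hv ℓ hℓ)⟩
  rw [Matrix.rank]
  omega
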